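/- arXiv:2107.10030 — 2 statements merged into one kernel-verified Lean document; each statement's English description precedes it below -/
import Mathlib

section
/- Let n ≥ 1, let W ∈ ℝⁿ be a nonzero vector, b ∈ ℝ, and let z = (z₁,…,zₙ) be a random vector whose coordinates are i.i.d. standard normal (i.e. z is distributed according to the n-fold product of the standard Gaussian measure on ℝ). For λ > 0 define Y_λ = sigmoid_λ(⟨W,z⟩ + b) where sigmoid_λ(t) = 1/(1 + exp(−t/λ)). Then as λ → 0⁺, Y_λ converges in distribution to the Bernoulli law with P(Y = 1) = 1 − Φ(−b/√(Σᵢ Wᵢ²)) and P(Y = 0) = Φ(−b/√(Σᵢ Wᵢ²)); equivalently, for every bounded continuous function f : ℝ → ℝ, lim_{λ→0⁺} E[f(Y_λ)] = f(0)·Φ(−b/√(Σᵢ Wᵢ²)) + f(1)·(1 − Φ(−b/√(Σᵢ Wᵢ²))). -/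
open MeasureTheory ProbabilityTheory Real Filter Topology

/-- Cumulative distribution function of the standard normal law `N(0,1)`. -/
noncomputable def stdNormalCDF (t : ℝ) : ℝ :=
  ((gaussianReal 0 1) (Set.Iic t)).toReal

/-- Tempered sigmoid with temperature `lam`. -/
noncomputable def sigmoidT (lam t : ℝ) : ℝ := 1 / (1 + Real.exp (-t / lam))

lemma map_pi_gauss (n : ℕ) (V : Fin n → ℝ) (hV : ∑ i, V i ^ 2 = 1) :
    (Measure.pi fun _ : Fin n => gaussianReal 0 1).map (fun z => ∑ i, V i * z i)
      = gaussianReal 0 1 := by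
  have hm : Measurable (fun z : Fin n → ℝ => ∑ i, V i * z i) := by fun_prop
  have := Measure.isProbabilityMeasure_map (μ := Measure.pi fun _ : Fin n => gaussianReal 0 1)
    hm.aemeasurable
  apply Measure.ext_of_charFun
  ext t
  rw [charFun_gaussianReal, charFun_apply_real,
    integral_map hm.aemeasurable (by fun_prop)]
  have h1 : ∀ z : Fin n → ℝ, Complex.exp (t * ((∑ i, V i * z i : ℝ) : ℂ) * Complex.I)
      = ∏ i, Complex.exp (((t * V i : ℝ) : ℂ) * (z i : ℂ) * Complex.I) := by
    intro z
    rw [← Complex.exp_sum]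
    congr 1
    push_cast
    rw [Finset.mul_sum, Finset.sum_mul]
    refine Finset.sum_congr rfl fun i _ => by ring
  simp_rw [h1]
  rw [integral_fintype_prod_eq_prod (𝕜 := ℂ)
    (f := fun i (x : ℝ) => Complex.exp (((t * V i : ℝ) : ℂ) * (x : ℂ) * Complex.I))]
  simp_rw [← charFun_apply_real, charFun_gaussianReal]
  rw [← Complex.exp_sum]
  congr 1
  have hV' : ∑ i, (V i : ℂ) ^ 2 = 1 := by exact_mod_cast hV
  have : ∀ i, (((t * V i : ℝ) : ℂ) * ((0 : ℝ) : ℂ) * Complex.I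
      - (((1 : NNReal) : ℝ) : ℂ) * ((t * V i : ℝ) : ℂ) ^ 2 / 2) = (-(t : ℂ) ^ 2 / 2) * (V i : ℂ) ^ 2 := by
    intro i; push_cast; ring
  simp only [this, ← Finset.mul_sum, hV']
  push_cast; ring

lemma sigmoidT_tendsto_zero {t : ℝ} (ht : t < 0) :
    Tendsto (fun lam => sigmoidT lam t) (nhdsWithin 0 (Set.Ioi 0)) (nhds 0) := by
  unfold sigmoidT
  have h : Tendsto (fun lam : ℝ => -t / lam) (nhdsWithin 0 (Set.Ioi 0)) atTop := by
    simp_rw [div_eq_mul_inv]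
    exact tendsto_inv_nhdsGT_zero.const_mul_atTop (by linarith)
  simp_rw [one_div]
  exact tendsto_inv_atTop_zero.comp
    (tendsto_atTop_add_const_left _ 1 (Real.tendsto_exp_atTop.comp h))

lemma sigmoidT_tendsto_one {t : ℝ} (ht : 0 < t) :
    Tendsto (fun lam => sigmoidT lam t) (nhdsWithin 0 (Set.Ioi 0)) (nhds 1) := by
  unfold sigmoidT
  have h : Tendsto (fun lam : ℝ => -t / lam) (nhdsWithin 0 (Set.Ioi 0)) atBot := by
    simp_rw [div_eq_mul_inv]
    exact tendsto_inv_nhdsGT_zero.const_mul_atTop_of_neg (by linarith)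
  have h2 := (Real.tendsto_exp_atBot.comp h).const_add 1
  have h3 := (tendsto_const_nhds (x := (1:ℝ))).div h2 (by norm_num)
  simpa [Function.comp_def, Pi.div_def] using h3

/-- Let `W ∈ ℝⁿ` be a nonzero vector, `b ∈ ℝ`, and `z` an i.i.d. standard normal vector.
As `λ → 0⁺`, `Y_λ = sigmoid_λ(⟨W,z⟩ + b)` converges in distribution to a Bernoulli law:
for every bounded continuous `f : ℝ → ℝ`,
`E[f(Y_λ)] → f(0)·Φ(−b/√(Σᵢ Wᵢ²)) + f(1)·(1 − Φ(−b/√(Σᵢ Wᵢ²)))`. -/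
theorem zero_temperature_limit_logitNormal
    (n : ℕ) (hn : 1 ≤ n) (W : Fin n → ℝ) (hW : W ≠ 0) (b : ℝ)
    (f : BoundedContinuousFunction ℝ ℝ) :
    Tendsto
      (fun lam : ℝ =>
        ∫ z : Fin n → ℝ, f (sigmoidT lam ((∑ i, W i * z i) + b))
          ∂(Measure.pi fun _ : Fin n => gaussianReal 0 1))
      (nhdsWithin 0 (Set.Ioi 0))
      (nhds (f 0 * stdNormalCDF (-b / Real.sqrt (∑ i, (W i) ^ 2))
        + f 1 * (1 - stdNormalCDF (-b / Real.sqrt (∑ i, (W i) ^ 2))))) := by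
  have hpos : 0 < ∑ i, (W i) ^ 2 := by
    obtain ⟨i, hi⟩ := Function.ne_iff.mp hW
    exact Finset.sum_pos' (fun i _ => sq_nonneg _) ⟨i, Finset.mem_univ _, by
      have : W i ≠ 0 := hi
      positivity⟩
  set s := Real.sqrt (∑ i, (W i) ^ 2) with hs
  have hs0 : 0 < s := Real.sqrt_pos.mpr hpos
  have hs2 : s ^ 2 = ∑ i, (W i) ^ 2 := Real.sq_sqrt hpos.le
  have hlaw := map_pi_gauss n (fun i => W i / s) (by
    simp_rw [div_pow]
    rw [← Finset.sum_div, ← hs2]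
    field_simp)
  have hsm : ∀ lam, Measurable (fun u : ℝ => f (sigmoidT lam (s * u + b))) := by
    intro lam
    refine f.continuous.measurable.comp ?_
    unfold sigmoidT
    fun_prop
  have hint : ∀ lam, ∫ z : Fin n → ℝ, f (sigmoidT lam ((∑ i, W i * z i) + b))
          ∂(Measure.pi fun _ : Fin n => gaussianReal 0 1)
        = ∫ u, f (sigmoidT lam (s * u + b)) ∂(gaussianReal 0 1) := by
    intro lam
    conv_rhs => rw [← hlaw]
    rw [integral_map (Measurable.aemeasurable (by fun_prop)) (hsm lam).aestronglyMeasurable]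
    refine integral_congr_ae (ae_of_all _ fun z => ?_)
    have : s * ∑ i, W i / s * z i = ∑ i, W i * z i := by
      rw [Finset.mul_sum]
      exact Finset.sum_congr rfl fun i _ => by field_simp
    simp only [this]
  simp_rw [hint]
  set c := -b / s with hc
  have hlim : f 0 * stdNormalCDF c + f 1 * (1 - stdNormalCDF c)
      = ∫ u, ((Set.Iic c).indicator (fun _ => f 0 - f 1) u + f 1) ∂(gaussianReal 0 1) := by
    rw [integral_add ((integrable_const _).indicator measurableSet_Iic) (integrable_const _),
      integral_indicator measurableSet_Iic]
    simp [stdNormalCDF, Measure.real]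
    ring
  rw [hlim]
  refine tendsto_integral_filter_of_dominated_convergence (fun _ => ‖f‖)
    (Eventually.of_forall fun lam => (hsm lam).aestronglyMeasurable)
    (Eventually.of_forall fun lam => ae_of_all _ fun u => f.norm_coe_le_norm _)
    (integrable_const _) ?_
  have := nullSingletonClass_gaussianReal (μ := 0) (v := 1) one_ne_zero
  have hne : ∀ᵐ u ∂(gaussianReal 0 1), u ≠ c := by
    simp [ae_iff]
  filter_upwards [hne] with u hu
  rcases lt_or_gt_of_ne hu with h | h
  · have h' : s * u + b < 0 := by
      rw [hc, lt_div_iff₀ hs0] at h; linarith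
    simpa [h.le, Function.comp_def] using (f.continuous.tendsto 0).comp (sigmoidT_tendsto_zero h')
  · have h' : 0 < s * u + b := by
      rw [hc, div_lt_iff₀ hs0] at h; linarith
    simpa [h, Function.comp_def] using (f.continuous.tendsto 1).comp (sigmoidT_tendsto_one h')
end

section
/- Let μ ∈ ℝ and σ > 0, and let Z be a real random variable with Gaussian law N(μ, σ²). For λ > 0 set Y_λ = sigmoid_λ(Z) with sigmoid_λ(t) = 1/(1 + exp(−t/λ)). Then for every bounded continuous function f : ℝ → ℝ, lim_{λ→0⁺} ∫ f(sigmoid_λ(z)) dN(μ,σ²)(z) = f(0)·Φ(−μ/σ) + f(1)·(1 − Φ(−μ/σ)). In particular Y_λ converges in distribution, as λ → 0⁺, to a Bernoulli random variable with success probability 1 − Φ(−μ/σ). -/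
open MeasureTheory ProbabilityTheory Real Filter Topology

lemma gaussian_Iic_zero (μ σ : ℝ) (hσ : 0 < σ) :
    (gaussianReal μ (Real.toNNReal (σ ^ 2))).real (Set.Iic 0) = stdNormalCDF (-μ / σ) := by
  have h1 : gaussianReal μ (Real.toNNReal (σ ^ 2))
      = ((gaussianReal 0 1).map (σ * ·)).map (· + μ) := by
    rw [gaussianReal_map_const_mul, gaussianReal_map_add_const]
    congr 1
    · simp
    · ext
      simp [Real.coe_toNNReal _ (sq_nonneg σ)]
  rw [h1, Measure.map_map (by fun_prop) (by fun_prop), measureReal_def,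
    Measure.map_apply (by fun_prop) measurableSet_Iic, stdNormalCDF]
  congr 2
  ext x
  simp only [Set.mem_preimage, Set.mem_Iic, Function.comp]
  rw [le_div_iff₀ hσ]
  constructor <;> intro h <;> linarith

lemma sigmoidT_tendsto_one_s1 {z : ℝ} (hz : 0 < z) :
    Tendsto (fun lam => sigmoidT lam z) (𝓝[>] 0) (𝓝 1) := by
  have h : Tendsto (fun lam : ℝ => -z / lam) (𝓝[>] 0) atBot := by
    simp only [div_eq_mul_inv]
    exact tendsto_inv_nhdsGT_zero.const_mul_atTop_of_neg (by linarith)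
  have h2 := (Real.tendsto_exp_atBot.comp h).const_add 1
  have h3 := h2.inv₀ (by norm_num)
  simpa [sigmoidT, Function.comp_def] using h3

lemma sigmoidT_tendsto_zero_s1 {z : ℝ} (hz : z < 0) :
    Tendsto (fun lam => sigmoidT lam z) (𝓝[>] 0) (𝓝 0) := by
  have h : Tendsto (fun lam : ℝ => -z / lam) (𝓝[>] 0) atTop := by
    simp only [div_eq_mul_inv]
    exact tendsto_inv_nhdsGT_zero.const_mul_atTop (by linarith)
  have h2 := tendsto_atTop_add_const_left _ 1 (Real.tendsto_exp_atTop.comp h)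
  simpa [sigmoidT, Function.comp_def, Pi.inv_def] using h2.inv_tendsto_atTop

/-- Let `Z ∼ N(μ, σ²)` with `σ > 0` and `Y_λ = sigmoid_λ(Z)`. Then for every bounded
continuous `f : ℝ → ℝ`,
`lim_{λ→0⁺} ∫ f(sigmoid_λ(z)) dN(μ,σ²)(z) = f(0)·Φ(−μ/σ) + f(1)·(1 − Φ(−μ/σ))`,
i.e. `Y_λ` converges in distribution to a Bernoulli of parameter `1 − Φ(−μ/σ)`. -/
theorem zero_temperature_limit_gaussian_sigmoid
    (μ σ : ℝ) (hσ : 0 < σ) (f : BoundedContinuousFunction ℝ ℝ) :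
    Tendsto
      (fun lam : ℝ =>
        ∫ z : ℝ, f (sigmoidT lam z) ∂(gaussianReal μ (Real.toNNReal (σ ^ 2))))
      (nhdsWithin 0 (Set.Ioi 0))
      (nhds (f 0 * stdNormalCDF (-μ / σ) + f 1 * (1 - stdNormalCDF (-μ / σ)))) := by
  have hv : Real.toNNReal (σ ^ 2) ≠ 0 := by
    have : 0 < σ ^ 2 := by positivity
    simpa using this.ne'
  have hint : ∫ z, ((Set.Iic (0 : ℝ)).indicator (fun _ => f 0 - f 1) z + f 1)
      ∂(gaussianReal μ (Real.toNNReal (σ ^ 2)))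
      = f 0 * stdNormalCDF (-μ / σ) + f 1 * (1 - stdNormalCDF (-μ / σ)) := by
    rw [integral_add ((integrable_const _).indicator measurableSet_Iic) (integrable_const _),
      integral_indicator_const _ measurableSet_Iic, gaussian_Iic_zero μ σ hσ]
    simp
    ring
  rw [← hint]
  refine tendsto_integral_filter_of_dominated_convergence (fun _ => ‖f‖) ?_ ?_
    (integrable_const _) ?_
  · refine Eventually.of_forall fun lam => ?_
    refine (f.continuous.measurable.comp ?_).aestronglyMeasurable
    unfold sigmoidT
    fun_prop
  · exact Eventually.of_forall fun lam => Eventually.of_forall fun z => f.norm_coe_le_norm _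
  · have h0 : ∀ᵐ z ∂(gaussianReal μ (Real.toNNReal (σ ^ 2))), z ≠ 0 :=
      (gaussianReal_absolutelyContinuous μ hv).ae_le (Measure.ae_ne volume 0)
    filter_upwards [h0] with z hz
    rcases lt_or_gt_of_ne hz with h | h
    · have := (f.continuous.tendsto 0).comp (sigmoidT_tendsto_zero_s1 h)
      simpa [Set.indicator, h.le, Function.comp_def] using this
    · have := (f.continuous.tendsto 1).comp (sigmoidT_tendsto_one_s1 h)
      simpa [Set.indicator, h.not_ge, Function.comp_def] using this
end
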